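/- For every integer c ≥ 0 and every real number δ > 0 there exists a natural number N(c,δ) with the following property: for every integer d ≥ N(c,δ) and every finite permutation group G ≤ Sym(Ω) of degree n = |Ω| such that the pointwise stabilizer G_(Δ) lies in the class Γ_d for every subset Δ ⊆ Ω of size c, one has |G| ≤ ((1+δ)·d/e)^{n-1}, where e denotes Euler's number. -/

import Mathlib

open scoped Pointwise

/-- A group `H` has a *section* isomorphic to the alternating group `A_d`, i.e. there are
subgroups `K ⊴ L ≤ H` with `L/K ≅ A_d`; equivalently, there is a subgroup `L ≤ H` and a
surjective homomorphism from `L` onto `A_d`. -/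
def HasAltSection (d : ℕ) (H : Type*) [Group H] : Prop :=
  ∃ (L : Subgroup H) (φ : ↥L →* alternatingGroup (Fin d)), Function.Surjective φ

/-- The class `Γ_d`: groups with no section isomorphic to the alternating group `A_d`. -/
def InGamma (d : ℕ) (H : Type*) [Group H] : Prop := ¬ HasAltSection d H

/-- A permutation group `G ≤ Sym(Ω)` is primitive if it acts transitively on `Ω` and
every block of the action is trivial (i.e. it preserves no nontrivial partition of `Ω`). -/
def IsPrimitivePerm {Ω : Type*} (G : Subgroup (Equiv.Perm Ω)) : Prop :=
  MulAction.IsPretransitive G Ω ∧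
    ∀ B : Set Ω, MulAction.IsBlock G B → MulAction.IsTrivialBlock B

/-- `G ≤ Sym(Ω)` has a base of size at most `k`: a subset of `Ω` of cardinality at most `k`
whose pointwise stabilizer in `G` is trivial.  The base size `b(G)` is the least such `k`,
so `b(G) ≤ k` is expressed by `HasBaseOfSize G k`. -/
def HasBaseOfSize {Ω : Type*} (G : Subgroup (Equiv.Perm Ω)) (k : ℕ) : Prop :=
  ∃ S : Finset Ω, S.card ≤ k ∧ ∀ g ∈ G, (∀ α ∈ S, g α = α) → g = 1

/-- The pointwise stabilizer `G_(Δ) = ⋂_{α ∈ Δ} G_α` of a subset `Δ ⊆ Ω` in `G ≤ Sym(Ω)`,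
as a subgroup of `G` (equal to `G` itself when `Δ` is empty). -/
def PointwiseStab {Ω : Type*} (G : Subgroup (Equiv.Perm Ω)) (Δ : Finset Ω) : Subgroup ↥G :=
  ⨅ α ∈ Δ, MulAction.stabilizer (↥G) α

open MulAction

section Sections

variable {d : ℕ} {H H' : Type*} [Group H] [Group H']

theorem HasAltSection.of_injective (f : H →* H') (hf : Function.Injective f)
    (h : HasAltSection d H) : HasAltSection d H' := by
  obtain ⟨L, φ, hφ⟩ := h
  let e := L.equivMapOfInjective f hf
  exact ⟨L.map f, φ.comp e.symm.toMonoidHom, hφ.comp e.symm.surjective⟩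

theorem HasAltSection.of_surjective (f : H →* H') (hf : Function.Surjective f)
    (h : HasAltSection d H') : HasAltSection d H := by
  obtain ⟨L, φ, hφ⟩ := h
  exact ⟨L.comap f, φ.comp (f.subgroupComap L),
    hφ.comp (f.subgroupComap_surjective_of_surjective L hf)⟩

theorem InGamma.subgroup (hH : InGamma d H) (L : Subgroup H) : InGamma d L :=
  fun h => hH (h.of_injective L.subtype L.subtype_injective)

theorem InGamma.range (hH : InGamma d H) (f : H →* H') : InGamma d f.range :=
  fun h => hH (h.of_surjective f.rangeRestrict f.rangeRestrict_surjective)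

/-- A subgroup of `Perm α` containing the alternating group has an `A_d`-section as soon as
`d ≤ |α|`. -/
theorem hasAltSection_of_alternatingGroup_le {α : Type*} [Fintype α] [DecidableEq α]
    {G : Subgroup (Equiv.Perm α)} (hG : alternatingGroup α ≤ G) (hd : d ≤ Fintype.card α) :
    HasAltSection d G := by
  obtain ⟨ι⟩ : Nonempty (Fin d ↪ α) :=
    Function.Embedding.nonempty_of_card_le (by simpa using hd)
  classical
  let e : Fin d ≃ {x // x ∈ Set.range ι} := Equiv.ofInjective ι ι.injective
  let j : Equiv.Perm (Fin d) →* Equiv.Perm α := Equiv.Perm.extendDomainHom e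
  have hj : ∀ σ : alternatingGroup (Fin d), j σ ∈ G := fun σ => hG <| by
    rw [Equiv.Perm.mem_alternatingGroup]
    exact (Equiv.Perm.sign_extendDomain _ e).trans σ.2
  let f : alternatingGroup (Fin d) →* G :=
    (j.comp (alternatingGroup (Fin d)).subtype).codRestrict G hj
  refine HasAltSection.of_injective f (fun a b hab => ?_)
    ⟨⊤, (Subgroup.topEquiv : _ ≃* alternatingGroup (Fin d)).toMonoidHom,
      Subgroup.topEquiv.surjective⟩
  exact Subtype.ext (Equiv.Perm.extendDomainHom_injective e (congrArg Subtype.val hab))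

end Sections

section OrbitBound

/-- Every permutation group of degree `n` in `Γ_d` has order at most `C ^ (n - 1)`. -/
def OrderBound (C : ℝ) (d n : ℕ) : Prop :=
  ∀ (X : Type) [Finite X], Nat.card X = n →
    ∀ G : Subgroup (Equiv.Perm X), InGamma d G → Nat.card G * C ≤ C ^ n

variable {C : ℝ} {d : ℕ} {G X : Type} [Group G] [MulAction G X]

theorem card_eq_card_range_toPermHom [FaithfulSMul G X] :
    Nat.card (toPermHom G X).range = Nat.card G :=
  (Nat.card_congr (MonoidHom.ofInjective (toPerm_injective)).toEquiv).symm

theorem card_range_toPermHom_mul_pow_le [Finite X] (hC : 0 ≤ C) (hG : InGamma d G)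
    (h : ∀ ω : orbitRel.Quotient G X, OrderBound C d (Nat.card ω.orbit)) :
    Nat.card (toPermHom G X).range * C ^ Nat.card (orbitRel.Quotient G X) ≤
      C ^ Nat.card X := by
  classical
  have := Fintype.ofFinite (orbitRel.Quotient G X)
  choose r hr using fun p : (toPermHom G X).range => p.2
  let F : (toPermHom G X).range →
      ∀ ω : orbitRel.Quotient G X, (toPermHom G ω.orbit).range :=
    fun p ω => ⟨toPermHom G ω.orbit (r p), r p, rfl⟩
  have hF : Function.Injective F := by
    intro p q hpq
    apply Subtype.ext
    rw [← hr p, ← hr q]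
    ext x
    have h1 := congrFun hpq (Quotient.mk'' x)
    have h2 := congrArg (fun s => s.1 ⟨x, by simp⟩) h1
    exact congrArg Subtype.val h2
  have h1 := Nat.card_le_card_of_injective F hF
  rw [Nat.card_pi] at h1
  calc (Nat.card (toPermHom G X).range : ℝ) * C ^ Nat.card (orbitRel.Quotient G X)
      ≤ (∏ ω : orbitRel.Quotient G X, (Nat.card (toPermHom G ω.orbit).range : ℝ)) *
          C ^ Nat.card (orbitRel.Quotient G X) := by
        gcongr
        exact_mod_cast h1
    _ = ∏ ω : orbitRel.Quotient G X, ((Nat.card (toPermHom G ω.orbit).range : ℝ) * C) := by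
        rw [Finset.prod_mul_distrib, Finset.prod_const, Nat.card_eq_fintype_card,
          Finset.card_univ]
    _ ≤ ∏ ω : orbitRel.Quotient G X, C ^ Nat.card ω.orbit := by
        gcongr with ω
        exact h ω _ rfl _ (hG.range _)
    _ = C ^ Nat.card X := by
        rw [Finset.prod_pow_eq_pow_sum, ← Nat.card_sigma,
          ← Nat.card_congr (selfEquivSigmaOrbits' G X)]

theorem card_mul_pow_le [Finite X] [FaithfulSMul G X] (hC : 0 ≤ C) (hG : InGamma d G)
    (h : ∀ ω : orbitRel.Quotient G X, OrderBound C d (Nat.card ω.orbit)) :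
    Nat.card G * C ^ Nat.card (orbitRel.Quotient G X) ≤ C ^ Nat.card X := by
  rw [← card_eq_card_range_toPermHom (G := G) (X := X)]
  exact card_range_toPermHom_mul_pow_le hC hG h

theorem orderBound_orbit_of_two_le [Finite X] {n : ℕ} (hn : Nat.card X = n)
    (h : ∀ k, 0 < k → k < n → OrderBound C d k)
    (h2 : 2 ≤ Nat.card (orbitRel.Quotient G X)) (ω : orbitRel.Quotient G X) :
    OrderBound C d (Nat.card ω.orbit) := by
  have : Nontrivial (orbitRel.Quotient G X) := Finite.one_lt_card_iff_nontrivial.1 h2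
  obtain ⟨ω', hω'⟩ := exists_ne ω
  obtain ⟨y, hy⟩ := ω'.nonempty_orbit
  have := ω.nonempty_orbit.to_subtype
  refine h _ Nat.card_pos ?_
  rw [← hn, Nat.card_coe_set_eq]
  refine Set.ncard_lt_card fun hu => hω' ?_
  have hy' : y ∈ ω.orbit := hu ▸ Set.mem_univ y
  rw [orbitRel.Quotient.mem_orbit] at hy hy'
  exact hy.symm.trans hy'

/-- The imprimitive case of the induction. -/
theorem card_mul_le_of_lt_of_lt [Finite G] [Finite X] [FaithfulSMul G X] [IsPretransitive G X]
    (hC : 1 ≤ C)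
    (hG : InGamma d G) {n : ℕ} (hn : Nat.card X = n)
    (h : ∀ k, 0 < k → k < n → OrderBound C d k) {x : X} {H : Subgroup G}
    (hxH : stabilizer G x < H) (hH : H < ⊤) : Nat.card G * C ≤ C ^ n := by
  let N := (toPermHom G (G ⧸ H)).ker
  have hm : 2 ≤ Nat.card (G ⧸ H) := by
    have h0 : H.index ≠ 1 := fun h1 => hH.ne (Subgroup.index_eq_one.1 h1)
    have h1 : H.index ≠ 0 := Subgroup.index_ne_zero_of_finite
    have : Nat.card (G ⧸ H) = H.index := rfl
    omega
  have hmn : Nat.card (G ⧸ H) < n := by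
    have h1 : (stabilizer G x).index = n := by
      rw [index_stabilizer_of_transitive, hn]
    rw [← h1]
    exact Subgroup.index_strictAnti hxH
  choose r hr using fun y : X => exists_smul_eq G x y
  have hF : ∀ (g : G) (y : X), ((r (g • y) : G) : G ⧸ H) = g • ((r y : G) : G ⧸ H) := by
    intro g y
    rw [MulAction.Quotient.smul_coe, eq_comm, QuotientGroup.eq]
    apply hxH.le
    rw [mem_stabilizer_iff, mul_smul, hr, smul_eq_mul, inv_smul_eq_iff, mul_smul, hr]
  have hcard : Nat.card (G ⧸ H) ≤ Nat.card (orbitRel.Quotient N X) := by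
    refine Nat.card_le_card_of_surjective
      (Quotient.lift (s := orbitRel N X) (fun y : X => ((r y : G) : G ⧸ H)) ?_) ?_
    · rintro a b ⟨k, rfl : (k : G) • b = a⟩
      have hk : toPermHom G (G ⧸ H) k = 1 := k.2
      have hk' := DFunLike.congr_fun hk ((r b : G) : G ⧸ H)
      exact (hF k b).trans hk'
    · intro q
      obtain ⟨g, rfl⟩ := QuotientGroup.mk_surjective q
      refine ⟨Quotient.mk'' (g • x), (hF g x).trans ?_⟩
      rw [MulAction.Quotient.smul_coe, QuotientGroup.eq]
      apply hxH.le
      rw [mem_stabilizer_iff]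
      simp only [smul_eq_mul, mul_inv_rev, inv_mul_cancel_right]
      rw [inv_smul_eq_iff, hr]
  have hN := card_mul_pow_le (X := X) (by linarith) (hG.subgroup N)
    (orderBound_orbit_of_two_le hn h (hm.trans hcard))
  have hY := h _ (by omega) hmn (G ⧸ H) rfl _ (hG.range (toPermHom G (G ⧸ H)))
  have hGN : Nat.card G = Nat.card (toPermHom G (G ⧸ H)).range * Nat.card N := by
    rw [← Nat.card_congr (QuotientGroup.quotientKerEquivRange _).toEquiv]
    exact Subgroup.card_eq_card_quotient_mul_card_subgroup N
  rw [hn] at hN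
  have hpos : 0 < C ^ Nat.card (orbitRel.Quotient N X) := by positivity
  refine le_of_mul_le_mul_right ?_ hpos
  calc (Nat.card G : ℝ) * C * C ^ Nat.card (orbitRel.Quotient N X)
      = (Nat.card (toPermHom G (G ⧸ H)).range * C) *
          (Nat.card N * C ^ Nat.card (orbitRel.Quotient N X)) := by
        rw [hGN]; push_cast; ring
    _ ≤ C ^ Nat.card (orbitRel.Quotient N X) * C ^ n := by
        gcongr
        exact hY.trans (pow_le_pow_right₀ hC hcard)
    _ = _ := mul_comm _ _

end OrbitBound

section GenericTuples

variable {G X : Type*} [Group G] [MulAction G X]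

/-- The points whose orbit under the pointwise stabilizer of `T` fills more than three quarters
of the domain. -/
def largeOrbitPoints (G : Type*) {X : Type*} [Group G] [MulAction G X] (T : Set X) : Set X :=
  {y | 3 * Nat.card X < 4 * (orbit (fixingSubgroup G T) y).ncard}

theorem smul_orbit_fixingSubgroup (g : G) (T : Set X) (y : X) :
    orbit (fixingSubgroup G (g • T)) (g • y) = g • orbit (fixingSubgroup G T) y := by
  ext z
  rw [Set.mem_smul_set_iff_inv_smul_mem]
  constructor
  · rintro ⟨⟨h, hh⟩, rfl⟩
    refine ⟨⟨g⁻¹ * h * g, ?_⟩, ?_⟩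
    · rw [mem_fixingSubgroup_iff] at hh ⊢
      intro t ht
      rw [mul_smul, mul_smul, hh _ (Set.smul_mem_smul_set ht), inv_smul_smul]
    · simp [Subgroup.smul_def, mul_smul]
  · rintro ⟨⟨h, hh⟩, hz⟩
    refine ⟨⟨g * h * g⁻¹, ?_⟩, ?_⟩
    · rw [mem_fixingSubgroup_iff] at hh ⊢
      intro t ht
      rw [mul_smul, mul_smul, hh _ (Set.mem_smul_set_iff_inv_smul_mem.1 ht), smul_inv_smul]
    · have hz' : h • y = g⁻¹ • z := hz
      simp [Subgroup.smul_def, mul_smul, hz']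

theorem smul_largeOrbitPoints (g : G) (T : Set X) :
    g • largeOrbitPoints G T = largeOrbitPoints G (g • T) := by
  ext z
  rw [Set.mem_smul_set_iff_inv_smul_mem, largeOrbitPoints, largeOrbitPoints, Set.mem_ofPred_eq,
    Set.mem_ofPred_eq]
  conv_rhs => rw [← smul_inv_smul g z, smul_orbit_fixingSubgroup, Set.ncard_smul_set]

theorem orbit_eq_of_mem_largeOrbitPoints [Finite X] {T : Set X} {y z : X}
    (hy : y ∈ largeOrbitPoints G T) (hz : z ∈ largeOrbitPoints G T) :
    orbit (fixingSubgroup G T) y = orbit (fixingSubgroup G T) z := by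
  rcases orbit.eq_or_disjoint (G := fixingSubgroup G T) y z with h | h
  · exact h
  · have h1 := Set.ncard_union_eq h
    have h2 := Set.ncard_le_card (orbit (fixingSubgroup G T) y ∪ orbit (fixingSubgroup G T) z)
    simp only [largeOrbitPoints, Set.mem_ofPred_eq] at hy hz
    omega

theorem lt_ncard_largeOrbitPoints [Finite X] {T : Set X} {y : X}
    (hy : y ∈ largeOrbitPoints G T) :
    3 * Nat.card X < 4 * (largeOrbitPoints G T).ncard := by
  have hsub : orbit (fixingSubgroup G T) y ⊆ largeOrbitPoints G T := by
    intro z hz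
    have : orbit (fixingSubgroup G T) z = orbit (fixingSubgroup G T) y := orbit_eq_iff.2 hz
    simpa only [largeOrbitPoints, Set.mem_ofPred_eq, this] using hy
  have := Set.ncard_le_ncard hsub
  simp only [largeOrbitPoints, Set.mem_ofPred_eq] at hy this ⊢
  omega

/-- Lists in which every entry lies in the large orbit of the pointwise stabilizer of the entries
that follow it. -/
def IsGeneric (G : Type*) {X : Type*} [Group G] [MulAction G X] : List X → Prop
  | [] => True
  | a :: l => IsGeneric G l ∧ a ∈ largeOrbitPoints G {x | x ∈ l}

theorem smul_setOf_mem (g : G) (l : List X) : g • {x | x ∈ l} = {x | x ∈ l.map (g • ·)} := by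
  ext z
  rw [Set.mem_smul_set]
  simp

theorem IsGeneric.smul (g : G) {l : List X} (h : IsGeneric G l) : IsGeneric G (l.map (g • ·)) := by
  induction l with
  | nil => trivial
  | cons a l ih =>
    refine ⟨ih h.1, ?_⟩
    rw [← smul_setOf_mem, ← smul_largeOrbitPoints]
    exact Set.smul_mem_smul_set h.2

theorem IsGeneric.exists_map_eq [Finite X] {l l' : List X} (h : IsGeneric G l)
    (h' : IsGeneric G l') (hl : l.length = l'.length) : ∃ g : G, l.map (g • ·) = l' := by
  induction l generalizing l' with
  | nil => exact ⟨1, by simpa [eq_comm] using hl⟩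
  | cons a l ih =>
    cases l' with
    | nil => simp at hl
    | cons b l' =>
      obtain ⟨g, rfl⟩ := ih h.1 h'.1 (by simpa using hl)
      have ha : g • a ∈ largeOrbitPoints G {x | x ∈ l.map (g • ·)} := (h.smul g).2
      have hab := orbit_eq_of_mem_largeOrbitPoints h'.2 ha
      obtain ⟨⟨k, hk⟩, hkb : k • g • a = b⟩ := orbit_eq_iff.1 hab
      refine ⟨k * g, ?_⟩
      rw [mem_fixingSubgroup_iff] at hk
      simp only [List.map_cons, mul_smul, hkb, List.cons.injEq, true_and]
      refine List.map_congr_left fun x hx => hk _ (List.mem_map_of_mem hx)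

theorem IsGeneric.swap [Finite X] {a b : X} {l : List X} (h : IsGeneric G (a :: b :: l)) :
    IsGeneric G (b :: a :: l) := by
  classical
  have := Fintype.ofFinite X
  have hb := lt_ncard_largeOrbitPoints h.1.2
  set O := largeOrbitPoints G {x | x ∈ l} with hO
  let N : Set (X × X) := {p | p.1 ∈ O ∧ p.2 ∈ largeOrbitPoints G {x | x ∈ p.1 :: l}}
  have hgen : ∀ p : X × X, p ∈ N → IsGeneric G (p.2 :: p.1 :: l) := fun p hp =>
    ⟨⟨h.1.1, hp.1⟩, hp.2⟩
  have hfib : ∀ y ∈ O, 3 * Nat.card X < 4 * (largeOrbitPoints G {x | x ∈ y :: l}).ncard := by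
    intro y hy
    obtain ⟨g, hg⟩ := IsGeneric.exists_map_eq h.1 (l' := y :: l) ⟨h.1.1, hy⟩ rfl
    have : g • a ∈ largeOrbitPoints G {x | x ∈ y :: l} := by
      rw [← hg]
      exact (h.smul g).2
    exact lt_ncard_largeOrbitPoints this
  have hN : Nat.card X * Nat.card X < 2 * N.ncard := by
    have e : N ≃ Σ y : O, largeOrbitPoints G {x | x ∈ y.1 :: l} :=
      { toFun := fun p => ⟨⟨p.1.1, p.2.1⟩, ⟨p.1.2, p.2.2⟩⟩
        invFun := fun q => ⟨(q.1.1, q.2.1), q.1.2, q.2.2⟩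
        left_inv := fun _ => rfl
        right_inv := fun _ => rfl }
    have h1 : N.ncard = ∑ y : O, (largeOrbitPoints G {x | x ∈ y.1 :: l}).ncard := by
      rw [← Nat.card_coe_set_eq, Nat.card_congr e, Nat.card_sigma]
      rfl
    have h2 : O.ncard * (3 * Nat.card X) ≤
        4 * ∑ y : O, (largeOrbitPoints G {x | x ∈ y.1 :: l}).ncard := by
      rw [Finset.mul_sum, ← Nat.card_coe_set_eq, Nat.card_eq_fintype_card, ← Finset.card_univ,
        ← smul_eq_mul]
      exact Finset.card_nsmul_le_sum _ _ _ fun y _ => (hfib y y.2).le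
    have : Nonempty X := ⟨a⟩
    have hpos : 0 < Nat.card X := Nat.card_pos
    rw [← h1] at h2
    nlinarith [Nat.mul_lt_mul_of_pos_right hb hpos]
  have hinter : (N ∩ Prod.swap ⁻¹' N).Nonempty := by
    have h1 : (Prod.swap ⁻¹' N).ncard = N.ncard :=
      Set.ncard_preimage_of_injective_subset_range Prod.swap_injective
        (Prod.swap_surjective.range_eq ▸ Set.subset_univ _)
    have h2 := Set.ncard_union_add_ncard_inter N (Prod.swap ⁻¹' N)
    have h3 := Set.ncard_le_card (N ∪ Prod.swap ⁻¹' N)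
    rw [Nat.card_prod] at h3
    rw [← Set.ncard_pos]
    omega
  obtain ⟨p, hp, hp'⟩ := hinter
  obtain ⟨g, hg⟩ := IsGeneric.exists_map_eq (hgen p hp) h rfl
  have := (hgen _ hp').smul g
  simp only [List.map_cons, List.cons.injEq, Prod.fst_swap, Prod.snd_swap] at hg this
  rwa [hg.1, hg.2.1, hg.2.2] at this

theorem IsGeneric.perm [Finite X] {l l' : List X} (hl : l.Perm l') (h : IsGeneric G l) :
    IsGeneric G l' := by
  induction hl with
  | nil => trivial
  | cons a hp ih =>
    refine ⟨ih h.1, ?_⟩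
    have h2 := h.2
    simp only [hp.mem_iff] at h2
    exact h2
  | swap a b l => exact h.swap
  | trans _ _ ih1 ih2 => exact ih2 (ih1 h)

theorem IsGeneric.nodup [Nontrivial X] [Finite X] {l : List X} (h : IsGeneric G l) : l.Nodup := by
  induction l with
  | nil => exact List.nodup_nil
  | cons a l ih =>
    refine List.nodup_cons.2 ⟨fun ha => ?_, ih h.1⟩
    have h1 : orbit (fixingSubgroup G {x | x ∈ l}) a = {a} := by
      refine Set.eq_singleton_iff_unique_mem.2 ⟨mem_orbit_self a, ?_⟩
      rintro _ ⟨⟨k, hk⟩, rfl⟩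
      exact (mem_fixingSubgroup_iff G).1 hk a ha
    have h2 := h.2
    have h3 := Finite.one_lt_card (α := X)
    simp only [largeOrbitPoints, Set.mem_ofPred_eq, h1, Set.ncard_singleton] at h2
    omega

theorem exists_isGeneric {d : ℕ}
    (h : ∀ T : Set X, T.ncard < d → (largeOrbitPoints G T).Nonempty) :
    ∀ k ≤ d, ∃ l : List X, l.length = k ∧ IsGeneric G l := by
  classical
  intro k
  induction k with
  | zero => exact fun _ => ⟨[], rfl, trivial⟩
  | succ k ih =>
    intro hk
    obtain ⟨l, rfl, hl⟩ := ih (by omega)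
    obtain ⟨a, ha⟩ := h {x | x ∈ l} (by
      have : {x | x ∈ l} = (l.toFinset : Set X) := by ext; simp
      rw [this, Set.ncard_coe_finset]
      have := l.toFinset_card_le
      omega)
    exact ⟨a :: l, rfl, hl, ha⟩

/-- If the pointwise stabilizer of every set of fewer than `d` points has a large orbit, then
some `d`-element set has its full symmetric group induced on it. -/
theorem hasAltSection_of_largeOrbitPoints_nonempty [Nontrivial X] [Finite X] {d : ℕ}
    (h : ∀ T : Set X, T.ncard < d → (largeOrbitPoints G T).Nonempty) : HasAltSection d G := by
  obtain ⟨l, rfl, hl⟩ := exists_isGeneric h d le_rfl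
  have hnd := hl.nodup
  have hinj : Function.Injective l.get := List.nodup_iff_injective_get.1 hnd
  let L : Subgroup G :=
    { carrier := {g | ∃ σ : alternatingGroup (Fin l.length), ∀ i, g • l.get i = l.get (σ.1 i)}
      one_mem' := ⟨1, fun i => by simp⟩
      mul_mem' := by
        rintro g g' ⟨σ, hσ⟩ ⟨τ, hτ⟩
        exact ⟨σ * τ, fun i => by rw [mul_smul, hτ, hσ]; rfl⟩
      inv_mem' := by
        rintro g ⟨σ, hσ⟩
        refine ⟨σ⁻¹, fun i => ?_⟩
        rw [inv_smul_eq_iff, hσ]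
        simp }
  choose f hf using fun g : L => g.2
  have huniq : ∀ (g : L) (σ : alternatingGroup (Fin l.length)),
      (∀ i, (g : G) • l.get i = l.get (σ.1 i)) → f g = σ := by
    intro g σ hσ
    ext i
    have := hinj ((hf g i).symm.trans (hσ i))
    rw [this]
  refine ⟨L, MonoidHom.mk' f fun g g' => huniq _ _ fun i => ?_, fun σ => ?_⟩
  · rw [Subgroup.coe_mul, mul_smul, hf, hf]; rfl
  · have hperm : l.Perm (List.ofFn (l.get ∘ σ.1)) := by
      conv_lhs => rw [← List.ofFn_get l]
      exact (Equiv.Perm.ofFn_comp_perm σ.1 l.get).symm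
    obtain ⟨g, hg⟩ := hl.exists_map_eq (hl.perm hperm) (by simp)
    have hg' : ∀ i, g • l.get i = l.get (σ.1 i) := by
      intro i
      have h1 : (l.map (g • ·))[i]? = (List.ofFn (l.get ∘ σ.1))[i]? := by rw [hg]
      simpa using h1
    exact ⟨⟨g, σ, hg'⟩, huniq _ _ hg'⟩

end GenericTuples

section Separation

variable {G X : Type*} [Group G] [MulAction G X]

/-- For a maximal point stabilizer, an invariant pseudometric takes on every pair of distinct
points at least a proportion `1 / R` of its largest value, where `R + 1` is the rank. -/
theorem dist_le_rank_mul_dist [IsPretransitive G X] {x : X} (hx : IsCoatom (stabilizer G x))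
    {R : ℕ} [Finite (orbitRel.Quotient (stabilizer G x) X)]
    (hR : Nat.card (orbitRel.Quotient (stabilizer G x) X) ≤ R + 1)
    {D : X → X → ℕ} (hself : ∀ y, D y y = 0) (hsymm : ∀ y z, D y z = D z y)
    (htri : ∀ u v w, D u w ≤ D u v + D v w) (hinv : ∀ (g : G) y z, D (g • y) (g • z) = D y z)
    {z : X} (hz : z ≠ x) (w : X) : D x w ≤ R * D x z := by
  obtain ⟨u, rfl⟩ := exists_smul_eq G x z
  set δ := D x (u • x) with hδ
  have key : ∀ k, (∀ w, D x w ≤ (k + 1) * δ → D x w ≤ k * δ) → ∀ w, D x w ≤ k * δ := by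
    intro k hk w
    have hstep : ∀ h : G, D (h • x) (h • u • x) = δ := fun h => hinv h _ _
    let K : Subgroup G :=
      { carrier := {g | ∀ h : G, D x (h • x) ≤ k * δ ↔ D x (h • g • x) ≤ k * δ}
        one_mem' := fun h => by rw [one_smul]
        mul_mem' := fun {a b} ha hb h => by
          rw [ha h, ← mul_smul, hb (h * a), mul_smul, mul_smul]
        inv_mem' := fun {a} ha h => by
          have := ha (h * a⁻¹)
          rw [mul_smul, mul_smul, inv_smul_smul] at this
          exact this.symm }
    have hK : stabilizer G x < K := by
      refine lt_of_le_of_ne (fun g hg h => by rw [mem_stabilizer_iff.1 hg]) fun h => hz ?_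
      have hu : u ∈ K := by
        intro h
        have h1 := htri x (h • x) (h • u • x)
        have h2 := htri x (h • u • x) (h • x)
        rw [hstep] at h1
        rw [hsymm (h • u • x), hstep] at h2
        exact ⟨fun h3 => hk _ (by linarith), fun h3 => hk _ (by linarith)⟩
      rw [← h] at hu
      exact hu
    have hKtop := hx.2 K hK
    obtain ⟨g, rfl⟩ := exists_smul_eq G x w
    have hg : g ∈ K := hKtop ▸ Subgroup.mem_top g
    have := (hg 1).1 (by rw [one_smul, hself]; exact Nat.zero_le _)
    rwa [one_smul] at this
  by_contra! hw
  let f : orbitRel.Quotient (stabilizer G x) X → ℕ :=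
    Quotient.lift (s := orbitRel (stabilizer G x) X) (D x) (by
      rintro a b ⟨k, rfl : (k : G) • b = a⟩
      have := hinv k x b
      rwa [mem_stabilizer_iff.1 k.2] at this)
  have hgrow : ∀ k ≤ R + 1, k + 1 ≤ {ω | f ω ≤ k * δ}.ncard := by
    intro k
    induction k with
    | zero =>
      intro _
      rw [zero_add, Nat.succ_le_iff, Set.ncard_pos]
      exact ⟨Quotient.mk'' x, by simp [f, hself]⟩
    | succ k ih =>
      intro hk
      refine (ih (by omega)).trans_lt (Set.ncard_lt_ncard ⟨fun ω hω => ?_, fun hsub => ?_⟩)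
      · exact le_trans hω (Nat.mul_le_mul_right _ (Nat.le_succ k))
      · have h1 := key k (fun w hw => hsub (a := Quotient.mk'' w) hw) w
        have h2 : k * δ ≤ R * δ := Nat.mul_le_mul_right _ (by omega)
        omega
  have h1 := hgrow (R + 1) le_rfl
  have h2 := Set.ncard_le_card {ω | f ω ≤ (R + 1) * δ}
  omega

/-- The number of elements `g` for which the translate `g • S` separates `y` from `z`. -/
noncomputable def sepCount (G : Type*) {X : Type*} [Group G] [MulAction G X] (S : Set X)
    (y z : X) : ℕ :=
  {g : G | ¬(y ∈ g • S ↔ z ∈ g • S)}.ncard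

variable (S : Set X)

theorem sepCount_self (y : X) : sepCount G S y y = 0 := by
  simp [sepCount]

theorem sepCount_comm (y z : X) : sepCount G S y z = sepCount G S z y := by
  simp only [sepCount, iff_comm]

theorem sepCount_triangle [Finite G] (u v w : X) :
    sepCount G S u w ≤ sepCount G S u v + sepCount G S v w := by
  refine (Set.ncard_le_ncard fun g hg => ?_).trans (Set.ncard_union_le _ _)
  by_contra h
  simp only [Set.mem_union, Set.mem_ofPred_eq, not_or, not_not] at h
  exact hg (h.1.trans h.2)

theorem sepCount_smul (h : G) (y z : X) :
    sepCount G S (h • y) (h • z) = sepCount G S y z := by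
  have : {g : G | ¬(h • y ∈ g • S ↔ h • z ∈ g • S)} =
      h • {g : G | ¬(y ∈ g • S ↔ z ∈ g • S)} := by
    ext g
    rw [Set.mem_smul_set_iff_inv_smul_mem]
    simp only [Set.mem_ofPred_eq, Set.mem_smul_set_iff_inv_smul_mem, smul_eq_mul, mul_inv_rev,
      inv_inv, mul_smul]
  rw [sepCount, this, Set.ncard_smul_set]
  rfl

theorem exists_card_le_six_mul_sepCount [Finite G] [Finite X] [Nonempty X] {S : Set X}
    (h1 : Nat.card X ≤ 4 * S.ncard) (h2 : 4 * S.ncard ≤ 3 * Nat.card X) :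
    ∃ y z : X, Nat.card G ≤ 6 * sepCount G S y z := by
  classical
  have := Fintype.ofFinite X
  have := Fintype.ofFinite G
  by_contra! hlt
  have hdc := Finset.sum_card_bipartiteAbove_eq_sum_card_bipartiteBelow
    (s := (Finset.univ : Finset G)) (t := (Finset.univ : Finset (X × X)))
    (fun g p => ¬(p.1 ∈ g • S ↔ p.2 ∈ g • S))
  have hl : ∀ g : G, 3 * Nat.card X ^ 2 ≤ 16 * (Finset.univ.bipartiteAbove
      (fun (g : G) (p : X × X) => ¬(p.1 ∈ g • S ↔ p.2 ∈ g • S)) g).card := by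
    intro g
    have hsub : ((g • S) ×ˢ (g • S)ᶜ).ncard ≤ (Finset.univ.bipartiteAbove
      (fun (g : G) (p : X × X) => ¬(p.1 ∈ g • S ↔ p.2 ∈ g • S)) g).card := by
      rw [← Set.ncard_coe_finset]
      refine Set.ncard_le_ncard fun p hp => ?_
      simp only [Finset.bipartiteAbove, Finset.coe_filter, Finset.mem_univ, true_and,
        Set.mem_ofPred_eq]
      exact fun hiff => hp.2 (hiff.1 hp.1)
    have hc := Set.ncard_add_ncard_compl (g • S)
    rw [Set.ncard_prod] at hsub
    rw [Set.ncard_smul_set] at hsub hc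
    nlinarith
  have hr : ∀ p : X × X, 6 * (Finset.univ.bipartiteBelow
      (fun (g : G) (p : X × X) => ¬(p.1 ∈ g • S ↔ p.2 ∈ g • S)) p).card ≤ Nat.card G := by
    intro p
    refine le_trans (le_of_eq ?_) (hlt p.1 p.2).le
    rw [sepCount, ← Set.ncard_coe_finset]
    simp [Finset.bipartiteBelow]
  have hL := Finset.card_nsmul_le_sum Finset.univ _ _ fun g _ => hl g
  have hR := Finset.sum_le_card_nsmul Finset.univ _ _ fun p _ => hr p
  rw [← Finset.mul_sum, smul_eq_mul, Finset.card_univ, ← Nat.card_eq_fintype_card] at hL hR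
  rw [Nat.card_prod] at hR
  rw [hdc] at hL
  have hX : 0 < Nat.card X := Nat.card_pos
  have hGp : 0 < Nat.card G := Nat.card_pos
  have : 0 < Nat.card G * Nat.card X ^ 2 := by positivity
  nlinarith

/-- If each pair of points is separated by a proportion at least `1 / M` of all translates of
`S`, then few translates separate all pairs of points. -/
theorem exists_translates_separating [Finite G] [Finite X] {S : Set X} {M m : ℕ}
    (hM : ∀ y z : X, y ≠ z → Nat.card G ≤ M * sepCount G S y z)
    (hm : (Nat.card X : ℝ) ^ 2 * (1 - 1 / M) ^ m < 1) :
    ∃ g : Fin m → G, ∀ y z : X, (∀ i, y ∈ g i • S ↔ z ∈ g i • S) → y = z := by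
  classical
  have := Fintype.ofFinite X
  have := Fintype.ofFinite G
  have hGp : 0 < Nat.card G := Nat.card_pos
  by_contra! hbad
  obtain ⟨y₀, z₀, -, hyz₀⟩ := hbad 1
  have hMpos : 0 < M := by
    rcases Nat.eq_zero_or_pos M with rfl | h
    · have := hM _ _ hyz₀
      omega
    · exact h
  let bad : X × X → Finset (Fin m → G) := fun p =>
    Fintype.piFinset fun _ => Finset.univ.filter fun g : G => (p.1 ∈ g • S ↔ p.2 ∈ g • S)
  have hcov : (Finset.univ : Finset (Fin m → G)) ⊆
      (Finset.univ.filter fun p : X × X => p.1 ≠ p.2).biUnion bad := by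
    intro g _
    obtain ⟨y, z, h1, h2⟩ := hbad g
    rw [Finset.mem_biUnion]
    exact ⟨(y, z), by simpa using h2, by simpa [bad, Fintype.mem_piFinset] using h1⟩
  have hcard : ∀ p : X × X, p.1 ≠ p.2 →
      ((bad p).card : ℝ) ≤ (Nat.card G * (1 - 1 / M)) ^ m := by
    intro p hp
    rw [Fintype.card_piFinset_const]
    push_cast
    refine pow_le_pow_left₀ (Nat.cast_nonneg _) ?_ m
    have h1 : sepCount G S p.1 p.2 +
        (Finset.univ.filter fun g : G => (p.1 ∈ g • S ↔ p.2 ∈ g • S)).card = Nat.card G := by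
      have h2 := Finset.card_filter_add_card_filter_not (s := (Finset.univ : Finset G))
        (fun g : G => (p.1 ∈ g • S ↔ p.2 ∈ g • S))
      rw [Finset.card_univ, ← Nat.card_eq_fintype_card] at h2
      rw [← h2, add_comm, sepCount, ← Set.ncard_coe_finset (Finset.univ.filter fun g : G => ¬ _)]
      simp
    have h2 : (Nat.card G : ℝ) ≤ M * sepCount G S p.1 p.2 := by exact_mod_cast hM _ _ hp
    have h3 : (Nat.card G : ℝ) / M ≤ sepCount G S p.1 p.2 := by
      rw [div_le_iff₀ (by positivity)]
      linarith
    rw [← h1] at h3 ⊢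
    push_cast at h3 ⊢
    rw [mul_sub, mul_one, mul_one_div]
    linarith
  have h1 := Finset.card_le_card hcov
  have h2 : ((Nat.card G : ℝ)) ^ m ≤ Nat.card X ^ 2 * (Nat.card G * (1 - 1 / M)) ^ m := by
    have hpos : (0 : ℝ) ≤ (Nat.card G * (1 - 1 / M)) ^ m :=
      le_trans (Nat.cast_nonneg _) (hcard (y₀, z₀) hyz₀)
    calc ((Nat.card G : ℝ)) ^ m = (Finset.univ : Finset (Fin m → G)).card := by
          simp
      _ ≤ ∑ p ∈ Finset.univ.filter fun p : X × X => p.1 ≠ p.2, ((bad p).card : ℝ) := by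
          exact_mod_cast h1.trans Finset.card_biUnion_le
      _ ≤ ∑ p ∈ Finset.univ.filter fun p : X × X => p.1 ≠ p.2,
            ((Nat.card G : ℝ) * (1 - 1 / M)) ^ m :=
          Finset.sum_le_sum fun p hp => hcard p (by simpa using hp)
      _ ≤ ∑ p : X × X, ((Nat.card G : ℝ) * (1 - 1 / M)) ^ m :=
          Finset.sum_le_sum_of_subset_of_nonneg (Finset.filter_subset _ _) fun _ _ _ => hpos
      _ = _ := by
          rw [Finset.sum_const, Finset.card_univ, Fintype.card_prod, nsmul_eq_mul]
          simp [sq]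
  rw [mul_pow, mul_left_comm] at h2
  have h3 : (0 : ℝ) < (Nat.card G : ℝ) ^ m := by positivity
  nlinarith

theorem card_le_pow_of_translates_separating [Finite X] [FaithfulSMul G X] {S T : Set X} {m : ℕ}
    (hS : ∀ k ∈ fixingSubgroup G T, k • S = S) (g : Fin m → G)
    (hg : ∀ y z : X, (∀ i, y ∈ g i • S ↔ z ∈ g i • S) → y = z) :
    Nat.card G ≤ Nat.card X ^ (m * T.ncard) := by
  let F : G → (Fin m × T → X) := fun h p => h • g p.1 • p.2.1
  have hF : Function.Injective F := by
    intro h h' hh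
    rw [← inv_mul_eq_one]
    refine FaithfulSMul.eq_of_smul_eq_smul (α := X) fun y => ?_
    rw [one_smul]
    refine hg _ _ fun i => ?_
    have hk : (g i)⁻¹ * (h⁻¹ * h') * g i ∈ fixingSubgroup G T := by
      rw [mem_fixingSubgroup_iff]
      intro t ht
      have := congrFun hh (i, ⟨t, ht⟩)
      simp only [F] at this
      rw [mul_smul, mul_smul, mul_smul, ← this, inv_smul_smul, inv_smul_smul]
    have h1 : (h⁻¹ * h') • g i • S = g i • S := by
      conv_rhs => rw [← hS _ hk]
      simp only [smul_smul]
      congr 1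
      group
    conv_lhs => rw [← h1]
    exact Set.smul_mem_smul_set_iff
  have h1 := Nat.card_le_card_of_injective F hF
  rwa [Nat.card_fun, Nat.card_prod, Nat.card_fin, Nat.card_coe_set_eq] at h1

theorem exists_invariant_of_orbit_le {K : Type*} [Group K] [MulAction K X] [Finite X]
    (h : ∀ y : X, 4 * (orbit K y).ncard ≤ 3 * Nat.card X) :
    ∃ S : Set X, (∀ k : K, k • S = S) ∧ Nat.card X ≤ 4 * S.ncard ∧
      4 * S.ncard ≤ 3 * Nat.card X := by
  obtain ⟨S, ⟨hinv, hS⟩, hmax⟩ := Set.exists_max_image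
    {S : Set X | (∀ k : K, k • S = S) ∧ 4 * S.ncard ≤ 3 * Nat.card X} Set.ncard
    (Set.toFinite _) ⟨∅, by simp⟩
  by_cases hlarge : Nat.card X ≤ 4 * S.ncard
  · exact ⟨S, hinv, hlarge, hS⟩
  obtain ⟨x, hx⟩ : ∃ x, x ∉ S := by
    by_contra! hall
    rw [Set.eq_univ_of_forall hall, Set.ncard_univ] at hlarge
    omega
  refine ⟨orbit K x, fun k => smul_orbit k x, ?_, h x⟩
  by_contra! hsmall
  have hu := Set.ncard_union_le S (orbit K x)
  have h1 := hmax (S ∪ orbit K x)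
    ⟨fun k => by rw [Set.smul_set_union, hinv, smul_orbit], by omega⟩
  have h2 : S.ncard < (S ∪ orbit K x).ncard :=
    Set.ncard_lt_ncard ⟨Set.subset_union_left, fun hsub => hx (hsub (.inr (mem_orbit_self x)))⟩
  omega

/-- The order of a primitive group of small rank in `Γ_d` is small. -/
theorem card_le_pow_of_isCoatom_stabilizer [Finite G] [Finite X] [Nontrivial X]
    [FaithfulSMul G X] [IsPretransitive G X] {x : X} (hx : IsCoatom (stabilizer G x)) {d : ℕ}
    (hG : InGamma d G) {R m : ℕ} (hR : Nat.card (orbitRel.Quotient (stabilizer G x) X) ≤ R + 1)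
    (hm : (Nat.card X : ℝ) ^ 2 * (1 - 1 / (6 * R : ℕ)) ^ m < 1) :
    Nat.card G ≤ Nat.card X ^ (m * d) := by
  obtain ⟨T, hT, hTo⟩ : ∃ T : Set X, T.ncard < d ∧ largeOrbitPoints G T = ∅ := by
    by_contra! h
    exact hG (hasAltSection_of_largeOrbitPoints_nonempty h)
  obtain ⟨S, hinv, h1, h2⟩ := exists_invariant_of_orbit_le (K := fixingSubgroup G T) (X := X)
    fun y => by
      by_contra! hy
      exact (hTo ▸ (show y ∈ largeOrbitPoints G T from hy) : y ∈ (∅ : Set X))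
  obtain ⟨u, v, huv⟩ := exists_card_le_six_mul_sepCount (G := G) h1 h2
  have hM : ∀ y z : X, y ≠ z → Nat.card G ≤ 6 * R * sepCount G S y z := by
    intro y z hyz
    obtain ⟨a, rfl⟩ := exists_smul_eq G x y
    obtain ⟨b, rfl⟩ := exists_smul_eq G x u
    have h3 := dist_le_rank_mul_dist hx hR (sepCount_self (G := G) S) (sepCount_comm S)
      (sepCount_triangle S) (sepCount_smul S) (z := a⁻¹ • z)
      (fun h => hyz (by rw [← h, smul_inv_smul])) (b⁻¹ • v)
    have h4 := sepCount_smul S b x (b⁻¹ • v)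
    have h5 := sepCount_smul S a x (a⁻¹ • z)
    rw [smul_inv_smul] at h4 h5
    rw [← h4, ← h5] at h3
    nlinarith
  obtain ⟨g, hg⟩ := exists_translates_separating hM hm
  refine (card_le_pow_of_translates_separating (fun k hk => hinv ⟨k, hk⟩) g hg).trans ?_
  exact Nat.pow_le_pow_right Nat.card_pos (Nat.mul_le_mul_left _ hT.le)

end Separation

section Bochert

/-- If the supports of `σ` and `τ` meet in a single point, then their commutator is a
3-cycle. -/
theorem isThreeCycle_commutator_of_support_inter {α : Type*} [Fintype α] [DecidableEq α]
    {σ τ : Equiv.Perm α} {a : α} (hσ : σ a ≠ a) (hτ : τ a ≠ a)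
    (h : ∀ x, σ x ≠ x → τ x ≠ x → x = a) : (σ * τ * σ⁻¹ * τ⁻¹).IsThreeCycle := by
  have hσ' : σ (σ a) ≠ σ a := fun h => hσ (σ.injective h)
  have hτ' : τ (τ a) ≠ τ a := fun h => hτ (τ.injective h)
  have h1 : τ (σ a) = σ a := by_contra fun h' => hσ (h _ hσ' h')
  have h2 : σ (τ a) = τ a := by_contra fun h' => hτ (h _ h' hτ')
  have hne : σ a ≠ τ a := fun h' => hσ' (by rw [h', h2])
  have key : σ * τ * σ⁻¹ * τ⁻¹ = Equiv.swap a (τ a) * Equiv.swap a (σ a) := by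
    rw [mul_inv_eq_iff_eq_mul, mul_inv_eq_iff_eq_mul]
    ext x
    simp only [Equiv.Perm.mul_apply]
    by_cases hxa : x = a
    · rw [hxa, h1, h2, Equiv.swap_apply_right, Equiv.swap_apply_left]
    by_cases hσx : σ x = x
    · have hx : x ≠ σ a := by rintro rfl; exact hσ' hσx
      rw [hσx]
      by_cases hτa : τ x = a
      · rw [hτa, Equiv.swap_apply_left, Equiv.swap_apply_of_ne_of_ne hσ hne]
      · have hτx : σ (τ x) = τ x := by
          by_contra h'
          exact hτa (h _ h' fun h'' => h' (by rw [τ.injective h'', hσx]))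
        rw [hτx, Equiv.swap_apply_of_ne_of_ne hτa (fun h' => hx (τ.injective (h'.trans h1.symm))),
          Equiv.swap_apply_of_ne_of_ne hτa (fun h' => hxa (τ.injective h'))]
    · have hτx : τ x = x := by_contra fun h' => hxa (h x hσx h')
      have hx : x ≠ τ a := by rintro rfl; exact hτ' hτx
      rw [hτx]
      by_cases hσa : σ x = a
      · rw [hσa, Equiv.swap_apply_of_ne_of_ne hτ hne.symm, Equiv.swap_apply_right]
      · have hτσ : τ (σ x) = σ x := by
          by_contra h'
          exact hσa (h _ (fun h'' => hσx (σ.injective h'')) h')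
        rw [hτσ, Equiv.swap_apply_of_ne_of_ne hσa (fun h' => hxa (σ.injective h')),
          Equiv.swap_apply_of_ne_of_ne hσa (fun h' => hx (σ.injective (h'.trans h2.symm)))]
  rw [key]
  exact Equiv.Perm.isThreeCycle_swap_mul_swap_same hτ.symm hσ.symm hne.symm

variable {X : Type*} [Fintype X] [DecidableEq X]

/-- **Bochert's theorem**, in terms of bases: a primitive group not containing the alternating
group has a base consisting of at most half of the points. -/
theorem exists_base_of_not_alternatingGroup_le
    {G : Subgroup (Equiv.Perm X)} (hprim : IsPreprimitive G X) (hG : ¬ alternatingGroup X ≤ G) :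
    ∃ B : Finset X, 2 * B.card ≤ Fintype.card X ∧ ∀ g ∈ G, (∀ x ∈ B, g x = x) → g = 1 := by
  classical
  obtain ⟨B, hB, hmin⟩ := Finset.exists_min_image
    (Finset.univ.filter fun B : Finset X => ∀ g ∈ G, (∀ x ∈ B, g x = x) → g = 1) Finset.card
    ⟨Finset.univ, Finset.mem_filter.2
      ⟨Finset.mem_univ _, fun g _ h => Equiv.ext fun x => h x (Finset.mem_univ x)⟩⟩
  simp only [Finset.mem_filter, Finset.mem_univ, true_and] at hB hmin
  refine ⟨B, ?_, hB⟩
  by_contra! hlt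
  have hcompl : Bᶜ.card < B.card := by
    have := B.card_add_card_compl
    omega
  have hnb : ∀ B' : Finset X, B'.card < B.card → ∃ g ∈ G, (∀ x ∈ B', g x = x) ∧ g ≠ 1 := by
    intro B' hB'
    by_contra! h
    exact absurd (hmin B' h) (by omega)
  obtain ⟨σ, hσG, hσ, hσ1⟩ := hnb _ hcompl
  obtain ⟨a, ha⟩ : ∃ a, σ a ≠ a := by
    by_contra! h
    exact hσ1 (Equiv.ext h)
  have haB : a ∈ B := by
    by_contra h
    exact ha (hσ a (Finset.mem_compl.2 h))
  obtain ⟨τ, hτG, hτ, hτ1⟩ := hnb (B.erase a) (Finset.card_erase_lt_of_mem haB)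
  have hτa : τ a ≠ a := fun h => hτ1 <| hB τ hτG fun x hx => by
    by_cases hxa : x = a
    · rwa [hxa]
    · exact hτ x (Finset.mem_erase.2 ⟨hxa, hx⟩)
  refine hG (Equiv.Perm.alternatingGroup_le_of_isPreprimitive_of_isThreeCycle_mem hprim
    (isThreeCycle_commutator_of_support_inter ha hτa fun x hx hx' => ?_)
    (G.mul_mem (G.mul_mem (G.mul_mem hσG hτG) (G.inv_mem hσG)) (G.inv_mem hτG)))
  by_contra hxa
  have hxB : x ∉ B := fun h => hx' (hτ x (Finset.mem_erase.2 ⟨hxa, h⟩))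
  exact hx (hσ x (Finset.mem_compl.2 hxB))

theorem card_le_pow_half_of_not_alternatingGroup_le
    {G : Subgroup (Equiv.Perm X)} (hprim : IsPreprimitive G X) (hG : ¬ alternatingGroup X ≤ G) :
    Nat.card G ^ 2 ≤ Nat.card X ^ Nat.card X := by
  obtain ⟨B, hB, hBG⟩ := exists_base_of_not_alternatingGroup_le hprim hG
  have hF : Function.Injective fun (g : G) (x : B) => g.1 x := by
    intro g h hgh
    have h1 := hBG (g⁻¹ * h).1 (g⁻¹ * h).2 fun x hx => by
      have := congrFun hgh ⟨x, hx⟩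
      simp only at this
      rw [Subgroup.coe_mul, Equiv.Perm.mul_apply, ← this]
      simp
    exact inv_mul_eq_one.1 (Subtype.ext h1)
  have h1 := Nat.card_le_card_of_injective _ hF
  rw [Nat.card_fun, Nat.card_eq_fintype_card (α := B), Fintype.card_coe] at h1
  rcases isEmpty_or_nonempty X with hX | hX
  · have : Subsingleton (Equiv.Perm X) := inferInstance
    simp
  · calc Nat.card G ^ 2 ≤ (Nat.card X ^ B.card) ^ 2 := Nat.pow_le_pow_left h1 2
      _ = Nat.card X ^ (2 * B.card) := by rw [← pow_mul, mul_comm]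
      _ ≤ _ := Nat.pow_le_pow_right Nat.card_pos (by rwa [Nat.card_eq_fintype_card])

end Bochert

section Numerics

theorem factorial_mul_le_pow {C : ℝ} {n : ℕ} (hn : n ≠ 0) (h : (n : ℝ) ≤ C) :
    (n.factorial : ℝ) * C ≤ C ^ n := by
  obtain ⟨m, rfl⟩ := Nat.exists_eq_succ_of_ne_zero hn
  have h0 : (0 : ℝ) ≤ (m.succ : ℕ) := Nat.cast_nonneg _
  have h1 : m.succ.factorial ≤ m.succ ^ m := by
    have := Nat.descFactorial_le_pow m.succ m
    have h2 := Nat.factorial_mul_descFactorial (Nat.le_succ m)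
    simpa [h2] using h2 ▸ (by simpa using this)
  calc (m.succ.factorial : ℝ) * C ≤ ((m.succ : ℕ) : ℝ) ^ m * C := by
        gcongr
        · linarith
        · exact_mod_cast h1
    _ ≤ C ^ m * C := by gcongr; linarith
    _ = C ^ m.succ := (pow_succ _ _).symm

theorem exp_one_mul_pow_succ_le (n : ℕ) :
    Real.exp 1 * (n : ℝ) ^ (n + 1) ≤ ((n + 1 : ℕ) : ℝ) ^ (n + 1) := by
  rcases Nat.eq_zero_or_pos n with rfl | hn
  · simp
  have hn' : (0 : ℝ) < n := Nat.cast_pos.2 hn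
  have h1 : (n : ℝ) / (n + 1 : ℕ) ≤ Real.exp (-(1 / (n + 1 : ℕ))) := by
    have := Real.add_one_le_exp (-(1 / ((n + 1 : ℕ) : ℝ)))
    refine le_trans (le_of_eq ?_) this
    push_cast
    field_simp
    ring
  have h2 : ((n : ℝ) / (n + 1 : ℕ)) ^ (n + 1) ≤ Real.exp (-1) := by
    calc ((n : ℝ) / (n + 1 : ℕ)) ^ (n + 1) ≤ Real.exp (-(1 / (n + 1 : ℕ))) ^ (n + 1) := by gcongr
      _ = Real.exp (-1) := by
        rw [← Real.exp_nat_mul]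
        congr 1
        field_simp
  rw [div_pow, div_le_iff₀ (by positivity), Real.exp_neg] at h2
  have := mul_le_mul_of_nonneg_left h2 (Real.exp_pos 1).le
  rwa [mul_inv_cancel_left₀ (Real.exp_ne_zero 1)] at this

theorem factorial_mul_exp_one_pow_le {n : ℕ} (hn : 1 ≤ n) :
    (n.factorial : ℝ) * Real.exp 1 ^ n ≤ Real.exp 1 * n * (n : ℝ) ^ n := by
  induction n, hn using Nat.le_induction with
  | base => simp
  | succ n hn ih =>
    have h := exp_one_mul_pow_succ_le n
    have he := Real.exp_pos 1
    calc ((n + 1).factorial : ℝ) * Real.exp 1 ^ (n + 1)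
        = (n + 1 : ℕ) * Real.exp 1 * (n.factorial * Real.exp 1 ^ n) := by
          rw [Nat.factorial_succ]; push_cast; ring
      _ ≤ (n + 1 : ℕ) * Real.exp 1 * (Real.exp 1 * n * (n : ℝ) ^ n) := by gcongr
      _ = Real.exp 1 * (n + 1 : ℕ) * (Real.exp 1 * (n : ℝ) ^ (n + 1)) := by ring
      _ ≤ _ := by gcongr

theorem factorial_mul_le_pow_of_lt {C δ : ℝ} {n d : ℕ} (hδ : 0 < δ)
    (hC : C = (1 + δ) * d / Real.exp 1) (hn : 1 ≤ n) (hCn : C ≤ n) (hnd : n ≤ d)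
    (h : Real.exp 1 * n ^ 2 ≤ (1 + δ) ^ n) : (n.factorial : ℝ) * C ≤ C ^ n := by
  have he := Real.exp_pos 1
  have h1 := factorial_mul_exp_one_pow_le hn
  have h2 : (n : ℝ) ≤ d := Nat.cast_le.2 hnd
  have h3 : (n.factorial : ℝ) * C * Real.exp 1 ^ n ≤ C ^ n * Real.exp 1 ^ n := by
    calc (n.factorial : ℝ) * C * Real.exp 1 ^ n
        ≤ n.factorial * n * Real.exp 1 ^ n := by gcongr
      _ = n * (n.factorial * Real.exp 1 ^ n) := by ring
      _ ≤ n * (Real.exp 1 * n * (n : ℝ) ^ n) := by gcongr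
      _ = (Real.exp 1 * n ^ 2) * (n : ℝ) ^ n := by ring
      _ ≤ (1 + δ) ^ n * (d : ℝ) ^ n := by gcongr
      _ = C ^ n * Real.exp 1 ^ n := by
        rw [← mul_pow, ← mul_pow, hC, div_mul_cancel₀ _ he.ne']
  exact le_of_mul_le_mul_right h3 (by positivity)

theorem eventually_mul_pow_le_pow {a : ℝ} (ha : 1 < a) (b : ℝ) (k : ℕ) :
    ∀ᶠ n : ℕ in Filter.atTop, b * (n : ℝ) ^ k ≤ a ^ n := by
  have h := (isLittleO_pow_const_const_pow_of_one_lt (R := ℝ) k ha).bound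
    (show (0 : ℝ) < 1 / (|b| + 1) by positivity)
  filter_upwards [h] with n hn
  rw [Real.norm_of_nonneg (by positivity), Real.norm_of_nonneg (by positivity), one_div,
    ← div_eq_inv_mul, le_div_iff₀ (by positivity)] at hn
  have : b * (n : ℝ) ^ k ≤ (|b| + 1) * (n : ℝ) ^ k := by
    gcongr
    linarith [le_abs_self b]
  linarith

theorem eventually_log_pow_mul_le :
    ∀ᶠ n : ℕ in Filter.atTop, ∀ d : ℕ, (d : ℝ) ^ 3 ≤ 27 * (n : ℝ) ^ 2 →
      13 * Real.log n ^ 3 * d ≤ (n : ℝ) - 1 := by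
  have h := (isLittleO_log_rpow_rpow_atTop 3 (show (0 : ℝ) < 1 / 3 by norm_num)).bound
    (show (0 : ℝ) < 1 / 78 by norm_num)
  filter_upwards [tendsto_natCast_atTop_atTop.eventually h, Filter.eventually_ge_atTop 2]
    with n hn hn2 d hd
  have hn2' : (2 : ℝ) ≤ n := by exact_mod_cast hn2
  have hL : 0 ≤ Real.log n := Real.log_natCast_nonneg n
  set t : ℝ := (n : ℝ) ^ (1 / 3 : ℝ) with ht
  have ht0 : 0 ≤ t := by positivity
  have ht3 : t ^ 3 = n := by
    rw [ht, ← Real.rpow_natCast, ← Real.rpow_mul (by positivity)]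
    norm_num
  rw [Real.norm_of_nonneg (by positivity), Real.norm_of_nonneg (by positivity)] at hn
  norm_cast at hn
  have hd' : (d : ℝ) ≤ 3 * t ^ 2 := by
    refine le_of_pow_le_pow_left₀ three_ne_zero (by positivity) ?_
    calc (d : ℝ) ^ 3 ≤ 27 * (n : ℝ) ^ 2 := hd
      _ = (3 * t ^ 2) ^ 3 := by rw [← ht3]; ring
  calc 13 * Real.log n ^ 3 * d ≤ 13 * (1 / 78 * t) * (3 * t ^ 2) := by
        gcongr
    _ = (n : ℝ) / 2 := by rw [← ht3]; ring
    _ ≤ _ := by linarith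

end Numerics

theorem card_eq_mul_card_stabilizer {G X : Type*} [Group G] [MulAction G X]
    [IsPretransitive G X] (x : X) : Nat.card G = Nat.card X * Nat.card (stabilizer G x) := by
  rw [← index_stabilizer_of_transitive G x, mul_comm, Subgroup.card_mul_index]

section Primitive

variable {X : Type} [Finite X] {G : Subgroup (Equiv.Perm X)} {C δ : ℝ} {d n : ℕ}

theorem card_subgroup_perm_le_factorial (G : Subgroup (Equiv.Perm X)) :
    Nat.card G ≤ (Nat.card X).factorial :=
  Nat.card_perm (α := X) ▸ Subgroup.card_le_card_group G

theorem card_mul_le_pow_of_sq_le (hprim : IsPreprimitive G X) (hG : InGamma d G)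
    (hn : Nat.card X = n) (hdn : d ≤ n) (hC : 1 ≤ C) (hn4 : 4 ≤ n)
    (h : (n : ℝ) ^ 2 ≤ C ^ 3) : Nat.card G * C ≤ C ^ n := by
  classical
  have := Fintype.ofFinite X
  subst hn
  have h1 : (Nat.card G : ℝ) ^ 2 ≤ (Nat.card X : ℝ) ^ Nat.card X := by
    exact_mod_cast card_le_pow_half_of_not_alternatingGroup_le hprim fun hA =>
      hG (hasAltSection_of_alternatingGroup_le hA (by rwa [← Nat.card_eq_fintype_card]))
  refine le_of_pow_le_pow_left₀ (n := 4) (by norm_num) (by positivity) ?_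
  calc ((Nat.card G : ℝ) * C) ^ 4 = ((Nat.card G : ℝ) ^ 2) ^ 2 * C ^ 4 := by ring
    _ ≤ ((Nat.card X : ℝ) ^ Nat.card X) ^ 2 * C ^ 4 := by gcongr
    _ = ((Nat.card X : ℝ) ^ 2) ^ Nat.card X * C ^ 4 := by ring
    _ ≤ (C ^ 3) ^ Nat.card X * C ^ 4 := by gcongr
    _ = C ^ (3 * Nat.card X + 4) := by ring
    _ ≤ C ^ (Nat.card X * 4) := pow_le_pow_right₀ hC (by omega)
    _ = _ := pow_mul _ _ _

theorem card_mul_le_pow_of_le_pow [IsPretransitive G X] (hG : InGamma d G)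
    (hn : Nat.card X = n) (h : ∀ k, 0 < k → k < n → OrderBound C d k) (hC : 1 ≤ C) {R : ℕ}
    (hR0 : 1 ≤ R) (x : X) (hR : Nat.card (orbitRel.Quotient (stabilizer G x) X) = R + 1)
    (hnR : (n : ℝ) ≤ C ^ R) : Nat.card G * C ≤ C ^ n := by
  have h1 := card_mul_pow_le (G := stabilizer G x) (X := X) (by linarith) (hG.subgroup _)
    (orderBound_orbit_of_two_le hn h (by omega))
  rw [hR, hn] at h1
  rw [card_eq_mul_card_stabilizer x, hn]
  push_cast
  calc (n : ℝ) * Nat.card (stabilizer G x) * C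
      ≤ C ^ R * Nat.card (stabilizer G x) * C := by gcongr
    _ = Nat.card (stabilizer G x) * C ^ (R + 1) := by ring
    _ ≤ C ^ n := h1

theorem card_mul_le_pow_of_pow_lt [Nontrivial X] [IsPretransitive G X] (hG : InGamma d G)
    (hn : Nat.card X = n) (hC : Real.exp 1 ≤ C) {R : ℕ} (hR0 : 1 ≤ R) {x : X}
    (hx : IsCoatom (stabilizer G x))
    (hR : Nat.card (orbitRel.Quotient (stabilizer G x) X) = R + 1)
    (hnR : C ^ R < n) (hlog : 13 * Real.log n ^ 3 * d ≤ (n : ℝ) - 1) :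
    Nat.card G * C ≤ C ^ n := by
  have he := Real.exp_pos 1
  have hC0 : 0 < C := he.trans_le hC
  have hn0 : (0 : ℝ) < n := (pow_pos hC0 R).trans hnR
  set L := Real.log n with hL
  have hlogC : 1 ≤ Real.log C := (Real.le_log_iff_exp_le hC0).2 hC
  have hRL : (R : ℝ) ≤ L := by
    have := Real.log_le_log (pow_pos hC0 R) hnR.le
    rw [Real.log_pow] at this
    nlinarith [(Nat.cast_nonneg R : (0 : ℝ) ≤ R)]
  have hR1 : (1 : ℝ) ≤ R := by exact_mod_cast hR0
  set m := ⌊12 * R * L⌋₊ + 1 with hm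
  have hm1 : 12 * R * L < m := by
    rw [hm]; push_cast; exact Nat.lt_floor_add_one _
  have hm2 : (m : ℝ) ≤ 13 * L ^ 2 := by
    have h1 : (⌊12 * R * L⌋₊ : ℝ) ≤ 12 * R * L := Nat.floor_le (by nlinarith)
    rw [hm]; push_cast
    nlinarith
  have hsep : (Nat.card X : ℝ) ^ 2 * (1 - 1 / (6 * R : ℕ)) ^ m < 1 := by
    rw [hn]
    have h1 : (1 : ℝ) - 1 / (6 * R : ℕ) ≤ Real.exp (-(1 / (6 * R : ℕ))) := by
      have := Real.add_one_le_exp (-(1 / ((6 * R : ℕ) : ℝ)))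
      linarith
    have h2 : (0 : ℝ) ≤ 1 - 1 / (6 * R : ℕ) := by
      rw [sub_nonneg, div_le_one (by positivity)]
      push_cast; linarith
    calc (n : ℝ) ^ 2 * (1 - 1 / (6 * R : ℕ)) ^ m
        ≤ (n : ℝ) ^ 2 * Real.exp (-(1 / (6 * R : ℕ))) ^ m := by gcongr
      _ = Real.exp (2 * L - m / (6 * R)) := by
        rw [← Real.exp_nat_mul, ← Real.exp_log hn0, ← Real.exp_nat_mul, ← Real.exp_add,
          ← hL]
        congr 1
        push_cast
        field_simp
        ring
      _ < 1 := by
        rw [Real.exp_lt_one_iff, sub_neg, lt_div_iff₀ (by positivity)]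
        linarith
  have hb := card_le_pow_of_isCoatom_stabilizer hx hG hR.le hsep
  have hb' : (Nat.card G : ℝ) ≤ (n : ℝ) ^ (m * d) := by rw [← hn]; exact_mod_cast hb
  have hn1 : 1 ≤ n := by exact_mod_cast hn0
  calc (Nat.card G : ℝ) * C ≤ (n : ℝ) ^ (m * d) * C := by gcongr
    _ ≤ C ^ (n - 1) * C := by
      gcongr
      rw [← Real.log_le_log_iff (by positivity) (by positivity), Real.log_pow, Real.log_pow,
        Nat.cast_sub hn1]
      push_cast
      have hL0 : 0 ≤ L := by linarith
      calc (m : ℝ) * d * L ≤ 13 * L ^ 2 * d * L := by gcongr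
        _ = 13 * L ^ 3 * d := by ring
        _ ≤ n - 1 := hlog
        _ ≤ (n - 1) * Real.log C := by
          have : (1 : ℝ) ≤ n := by exact_mod_cast hn1
          nlinarith
    _ = C ^ n := by rw [← pow_succ, Nat.sub_add_cancel hn1]

theorem two_le_card_quotient_stabilizer [Nontrivial X] [IsPretransitive G X] (x : X) :
    2 ≤ Nat.card (orbitRel.Quotient (stabilizer G x) X) := by
  obtain ⟨y, hy⟩ := exists_ne x
  have : Nontrivial (orbitRel.Quotient (stabilizer G x) X) := by
    refine ⟨Quotient.mk _ y, Quotient.mk _ x, fun h => hy ?_⟩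
    obtain ⟨g, hg⟩ := (orbitRel_apply.1 (Quotient.exact h) : y ∈ orbit (stabilizer G x) x)
    exact hg.symm.trans g.2
  exact Finite.one_lt_card

/-- The order bound for primitive groups. -/
theorem card_mul_le_pow_of_isCoatom [Nontrivial X] [IsPretransitive G X] {x : X}
    (hx : IsCoatom (stabilizer G x)) (hG : InGamma d G) (hδ : 0 < δ)
    (hCd : C = (1 + δ) * d / Real.exp 1) (hC : Real.exp 1 ≤ C) (hn : Nat.card X = n)
    (h : ∀ k, 0 < k → k < n → OrderBound C d k)
    (hlarge : C < n → 4 ≤ n ∧ Real.exp 1 * n ^ 2 ≤ (1 + δ) ^ n ∧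
      ∀ d : ℕ, (d : ℝ) ^ 3 ≤ 27 * (n : ℝ) ^ 2 → 13 * Real.log n ^ 3 * d ≤ (n : ℝ) - 1) :
    Nat.card G * C ≤ C ^ n := by
  have hC1 : 1 ≤ C := (Real.one_le_exp zero_le_one).trans hC
  have hn0 : n ≠ 0 := hn ▸ Nat.card_pos.ne'
  have hfac : (Nat.card G : ℝ) * C ≤ n.factorial * C := by
    have := hn ▸ card_subgroup_perm_le_factorial G
    gcongr
  rcases le_or_gt (n : ℝ) C with hnC | hnC
  · exact hfac.trans (factorial_mul_le_pow hn0 hnC)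
  obtain ⟨hn4, hexp, hlog⟩ := hlarge hnC
  rcases le_or_gt n d with hnd | hnd
  · exact hfac.trans (factorial_mul_le_pow_of_lt hδ hCd (by omega) hnC.le hnd hexp)
  rcases le_or_gt ((n : ℝ) ^ 2) (C ^ 3) with hsq | hsq
  · exact card_mul_le_pow_of_sq_le ((isCoatom_stabilizer_iff_preprimitive G x).1 hx) hG hn
      hnd.le hC1 hn4 hsq
  obtain ⟨R, hR⟩ : ∃ R, Nat.card (orbitRel.Quotient (stabilizer G x) X) = R + 1 :=
    ⟨_, (Nat.sub_add_cancel (one_le_two.trans (two_le_card_quotient_stabilizer x))).symm⟩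
  have hR0 : 1 ≤ R := by
    have := two_le_card_quotient_stabilizer (G := G) x
    omega
  rcases le_or_gt (n : ℝ) (C ^ R) with hnR | hnR
  · exact card_mul_le_pow_of_le_pow hG hn h hC1 hR0 x hR hnR
  · refine card_mul_le_pow_of_pow_lt hG hn hC hR0 hx hR hnR (hlog d ?_)
    have hdC : (d : ℝ) ≤ 3 * C := by
      have h1 : C * Real.exp 1 = (1 + δ) * d := by
        rw [hCd, div_mul_cancel₀ _ (Real.exp_pos 1).ne']
      nlinarith [Real.exp_one_lt_d9, (Nat.cast_nonneg d : (0 : ℝ) ≤ d)]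
    calc (d : ℝ) ^ 3 ≤ (3 * C) ^ 3 := by gcongr
      _ = 27 * C ^ 3 := by ring
      _ ≤ _ := by linarith

end Primitive

theorem exists_forall_orderBound {δ : ℝ} (hδ : 0 < δ) :
    ∃ N : ℕ, ∀ d : ℕ, N ≤ d → ∀ n : ℕ, 0 < n →
      OrderBound ((1 + δ) * d / Real.exp 1) d n := by
  obtain ⟨n₀, hn₀⟩ := Filter.eventually_atTop.1 ((Filter.eventually_ge_atTop 4).and
    ((eventually_mul_pow_le_pow (a := 1 + δ) (by linarith) (Real.exp 1) 2).and
      eventually_log_pow_mul_le))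
  have he := Real.exp_pos 1
  obtain ⟨N, hN⟩ := exists_nat_ge (Real.exp 1 * max (n₀ : ℝ) (Real.exp 1))
  refine ⟨N, fun d hd => ?_⟩
  set C := (1 + δ) * d / Real.exp 1 with hCd
  have hC : max (n₀ : ℝ) (Real.exp 1) ≤ C := by
    rw [hCd, le_div_iff₀ he]
    have : (N : ℝ) ≤ d := Nat.cast_le.2 hd
    nlinarith [(Nat.cast_nonneg d : (0 : ℝ) ≤ d)]
  have hC1 : 1 ≤ C := (Real.one_le_exp zero_le_one).trans ((le_max_right _ _).trans hC)
  intro n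
  induction n using Nat.strong_induction_on with
  | _ n ih =>
    intro hn X _ hX G hG
    have ih' : ∀ k, 0 < k → k < n → OrderBound C d k := fun k hk hkn => ih k hkn hk
    rcases Nat.lt_or_ge 1 n with hn1 | hn1
    · have : Nontrivial X := Finite.one_lt_card_iff_nontrivial.1 (hX ▸ hn1)
      rcases Nat.lt_or_ge 1 (Nat.card (orbitRel.Quotient G X)) with ho | ho
      · have h1 := card_mul_pow_le (G := G) (X := X) (by linarith) hG
          (orderBound_orbit_of_two_le hX ih' ho)
        rw [hX] at h1
        refine le_trans ?_ h1
        gcongr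
        exact le_self_pow₀ hC1 (by omega)
      · have : Subsingleton (orbitRel.Quotient G X) := Finite.card_le_one_iff_subsingleton.1 ho
        have : IsPretransitive G X := pretransitive_iff_subsingleton_quotient G X |>.2 this
        obtain ⟨x⟩ : Nonempty X := inferInstance
        by_cases hx : IsCoatom (stabilizer G x)
        · refine card_mul_le_pow_of_isCoatom hx hG hδ hCd ((le_max_right _ _).trans hC) hX ih'
            fun hCn => hn₀ n ?_
          exact_mod_cast (((le_max_left _ _).trans hC).trans_lt hCn).le
        · have htop : stabilizer G x ≠ ⊤ := fun htop => by
            have := index_stabilizer_of_transitive G x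
            rw [htop, Subgroup.index_top] at this
            omega
          simp only [IsCoatom, not_and, not_forall] at hx
          obtain ⟨H, hxH, hH⟩ := hx htop
          exact card_mul_le_of_lt_of_lt hC1 hG hX ih' hxH (lt_top_iff_ne_top.2 hH)
    · obtain rfl : n = 1 := by omega
      have : Subsingleton X := (Nat.card_eq_one_iff_unique.1 hX).1
      simp

theorem card_le_pow_mul_card_pointwiseStab {Ω : Type*} [Finite Ω] (G : Subgroup (Equiv.Perm Ω))
    (Δ : Finset Ω) :
    Nat.card G ≤ Nat.card Ω ^ Δ.card * Nat.card (PointwiseStab G Δ) := by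
  rw [← Subgroup.index_mul_card (PointwiseStab G Δ)]
  refine Nat.mul_le_mul_right _ ?_
  have hF : ∀ g h : G, (fun x : Δ => g.1 x) = (fun x : Δ => h.1 x) →
      (g : G ⧸ PointwiseStab G Δ) = h := by
    intro g h hgh
    rw [QuotientGroup.eq]
    simp only [PointwiseStab, Subgroup.mem_iInf, mem_stabilizer_iff]
    intro α hα
    have := congrFun hgh ⟨α, hα⟩
    rw [mul_smul, inv_smul_eq_iff]
    exact this.symm
  have h1 := Nat.card_le_card_of_injective
    (fun (q : G ⧸ PointwiseStab G Δ) (x : Δ) => q.out.1 x) fun q q' h => by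
      simpa using hF _ _ h
  rwa [Nat.card_fun, Nat.card_eq_fintype_card (α := Δ), Fintype.card_coe] at h1

/-- **Theorem 2 (Burness–Shalev).** For every `c ≥ 0` and `δ > 0` there is `N(c,δ)` such
that for all `d ≥ N(c,δ)`: if `G ≤ Sym(Ω)` has degree `n` and the pointwise stabilizer of
every `c`-element subset of `Ω` lies in `Γ_d`, then `|G| ≤ ((1+δ)d/e)^{n-1}`. -/
theorem order_le_of_c_point_stabilizers_in_gamma (c : ℕ) (δ : ℝ) (hδ : 0 < δ) :
    ∃ N : ℕ, ∀ d : ℕ, N ≤ d → ∀ (Ω : Type) [Fintype Ω],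
      ∀ G : Subgroup (Equiv.Perm Ω),
        (∀ Δ : Finset Ω, Δ.card = c → InGamma d ↥(PointwiseStab G Δ)) →
        (Nat.card ↥G : ℝ) ≤ ((1 + δ) * d / Real.exp 1) ^ (Fintype.card Ω - 1) := by
  obtain ⟨N₁, hN₁⟩ := exists_forall_orderBound (half_pos hδ)
  have hq : 1 < (1 + δ) / (1 + δ / 2) := by
    rw [one_lt_div (by positivity)]
    linarith
  set q := (1 + δ) / (1 + δ / 2) with hqdef
  obtain ⟨n₀, hn₀⟩ := Filter.eventually_atTop.1 ((Filter.eventually_ge_atTop (c + 1)).and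
    (eventually_mul_pow_le_pow hq q c))
  have he := Real.exp_pos 1
  obtain ⟨N₂, hN₂⟩ := exists_nat_ge (Real.exp 1 * max (n₀ : ℝ) 1)
  refine ⟨max N₁ N₂, fun d hd Ω _ G hG => ?_⟩
  set C := (1 + δ) * d / Real.exp 1 with hC
  have hdN : (N₂ : ℝ) ≤ d := Nat.cast_le.2 ((le_max_right _ _).trans hd)
  have hCmax : max (n₀ : ℝ) 1 ≤ C := by
    rw [hC, le_div_iff₀ he]
    nlinarith [(Nat.cast_nonneg d : (0 : ℝ) ≤ d)]
  have hC0 : 0 < C := one_pos.trans_le ((le_max_right _ _).trans hCmax)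
  rcases Nat.eq_zero_or_pos (Fintype.card Ω) with h0 | hpos
  · have := Fintype.card_eq_zero_iff.1 h0
    simp
  rw [← mul_le_mul_iff_of_pos_right hC0, ← pow_succ, Nat.sub_add_cancel hpos]
  rcases Nat.lt_or_ge (Fintype.card Ω) n₀ with hlt | hge
  · have h1 := card_subgroup_perm_le_factorial G
    rw [Nat.card_eq_fintype_card (α := Ω)] at h1
    have h2 : (Fintype.card Ω : ℝ) ≤ C :=
      (Nat.cast_le.2 hlt.le).trans ((le_max_left _ _).trans hCmax)
    calc (Nat.card G : ℝ) * C ≤ (Fintype.card Ω).factorial * C := by gcongr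
      _ ≤ _ := factorial_mul_le_pow hpos.ne' h2
  · obtain ⟨hc, hpow⟩ := hn₀ _ hge
    obtain ⟨Δ, -, hΔ⟩ := Finset.exists_subset_card_eq
      (show c ≤ (Finset.univ : Finset Ω).card by rw [Finset.card_univ]; omega)
    set S := (PointwiseStab G Δ).map G.subtype with hS
    have e : PointwiseStab G Δ ≃* S := Subgroup.equivMapOfInjective _ _ G.subtype_injective
    have hSG : InGamma d S := fun h => hG Δ hΔ (h.of_injective e.symm.toMonoidHom e.symm.injective)
    have h1 := hN₁ d ((le_max_left _ _).trans hd) _ hpos Ω Nat.card_eq_fintype_card S hSG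
    rw [← Nat.card_congr e.toEquiv] at h1
    set C' := (1 + δ / 2) * d / Real.exp 1 with hC'
    have hqC : q * C' = C := by
      rw [hqdef, hC', hC]
      field_simp
    have h2 := card_le_pow_mul_card_pointwiseStab G Δ
    rw [hΔ, Nat.card_eq_fintype_card (α := Ω)] at h2
    calc (Nat.card G : ℝ) * C
        ≤ ((Fintype.card Ω) ^ c * Nat.card (PointwiseStab G Δ) : ℕ) * C := by gcongr
      _ = (q * (Fintype.card Ω : ℝ) ^ c) * (Nat.card (PointwiseStab G Δ) * C') := by
        rw [← hqC]; push_cast; ring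
      _ ≤ q ^ Fintype.card Ω * C' ^ Fintype.card Ω := by gcongr
      _ = C ^ Fintype.card Ω := by rw [← mul_pow, hqC]
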